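/- arXiv:math/0311469 — 2 statements merged into one kernel-verified Lean document; each statement's English description precedes it below -/
import Mathlib

section
/- For every integer n ≥ 1 and all i, j ∈ ℤ: (0) ⟨T_n(J) e_i, e_j⟩ = 0 whenever |i − j| > n; (i) ⟨T_n(J) e_i, e_{i+n}⟩ = p_{i+1}·p_{i+2}·⋯·p_{i+n}; (ii) ⟨T_n(J) e_i, e_{i+n−1}⟩ = p_{i+1}·⋯·p_{i+n−1}·( q_i + q_{i+1} + ⋯ + q_{i+n−1} ); and, if n ≥ 2, (iii) ⟨T_n(J) e_i, e_{i+n−2}⟩ = p_{i+1}·⋯·p_{i+n−2}·[ Σ_{k=i}^{i+n−1} (p_k² − 1) + Σ_{i ≤ k ≤ l ≤ i+n−2} q_k·q_l ]. -/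
open Polynomial
open scoped ENNReal RealInnerProductSpace

noncomputable section

/-- The real Hilbert space `ℓ²(ℤ)`. -/
abbrev HZ : Type := lp (fun _ : ℤ => ℝ) 2

/-- The standard orthonormal basis of `ℓ²(ℤ)`. -/
def ez (k : ℤ) : HZ := lp.single 2 k 1

/-- Chebyshev polynomials of the first kind normalized to `[-2,2]`. -/
def T : ℕ → Polynomial ℝ
  | 0 => Polynomial.C 2
  | 1 => Polynomial.X
  | (n + 2) => Polynomial.X * T (n + 1) - T n

theorem prod_Icc_int_left (f : ℤ → ℝ) {a b : ℤ} (h : a ≤ b) :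
    ∏ k ∈ Finset.Icc a b, f k = f a * ∏ k ∈ Finset.Icc (a + 1) b, f k := by
  have hs : Finset.Icc a b = insert a (Finset.Icc (a + 1) b) := by
    ext x
    simp only [Finset.mem_insert, Finset.mem_Icc]
    omega
  rw [hs, Finset.prod_insert (by simp)]

theorem sum_Icc_int_left (f : ℤ → ℝ) {a b : ℤ} (h : a ≤ b) :
    ∑ k ∈ Finset.Icc a b, f k = f a + ∑ k ∈ Finset.Icc (a + 1) b, f k := by
  have hs : Finset.Icc a b = insert a (Finset.Icc (a + 1) b) := by
    ext x
    simp only [Finset.mem_insert, Finset.mem_Icc]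
    omega
  rw [hs, Finset.sum_insert (by simp)]

theorem inner_ez (i j : ℤ) : ⟪ez i, ez j⟫ = if i = j then (1 : ℝ) else 0 := by
  rw [ez, ez, lp.inner_single_left, lp.single_apply, Pi.single_apply]
  split_ifs <;> simp_all

section JacobiEntries

variable {p q : ℤ → ℝ} {J : HZ →L[ℝ] HZ}

theorem inner_T_zero (i j : ℤ) :
    ⟪aeval J (T 0) (ez i), ez j⟫ = if i = j then (2 : ℝ) else 0 := by
  rw [T, aeval_C, ContinuousLinearMap.algebraMap_apply, real_inner_smul_left, inner_ez]
  split_ifs <;> simp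

theorem inner_T_one
    (hJ : ∀ k : ℤ, J (ez k) = p k • ez (k - 1) + q k • ez k + p (k + 1) • ez (k + 1))
    (i j : ℤ) :
    ⟪aeval J (T 1) (ez i), ez j⟫ = p i * (if i - 1 = j then 1 else 0)
      + q i * (if i = j then 1 else 0) + p (i + 1) * (if i + 1 = j then 1 else 0) := by
  rw [T, aeval_X, hJ]
  simp only [inner_add_left, real_inner_smul_left, inner_ez]

theorem inner_T_add_two
    (hJ : ∀ k : ℤ, J (ez k) = p k • ez (k - 1) + q k • ez k + p (k + 1) • ez (k + 1))
    (n : ℕ) (i j : ℤ) :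
    ⟪aeval J (T (n + 2)) (ez i), ez j⟫ = p i * ⟪aeval J (T (n + 1)) (ez (i - 1)), ez j⟫
      + q i * ⟪aeval J (T (n + 1)) (ez i), ez j⟫
      + p (i + 1) * ⟪aeval J (T (n + 1)) (ez (i + 1)), ez j⟫
      - ⟪aeval J (T n) (ez i), ez j⟫ := by
  rw [T, mul_comm, map_sub, map_mul, aeval_X, sub_apply,
    mul_apply_eq_comp, hJ]
  simp only [map_add, map_smul, inner_sub_left, inner_add_left, real_inner_smul_left]

theorem inner_T_eq_zero
    (hJ : ∀ k : ℤ, J (ez k) = p k • ez (k - 1) + q k • ez k + p (k + 1) • ez (k + 1)) (n : ℕ) :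
    ∀ i j : ℤ, (n : ℤ) < |i - j| → ⟪aeval J (T n) (ez i), ez j⟫ = 0 := by
  induction n using Nat.twoStepInduction with
  | zero =>
    intro i j h
    rw [inner_T_zero, if_neg]
    rintro rfl
    simp at h
  | one =>
    intro i j h
    rw [lt_abs] at h
    rw [inner_T_one hJ, if_neg (by omega), if_neg (by omega), if_neg (by omega)]
    ring
  | more n ih₀ ih₁ =>
    intro i j h
    rw [lt_abs] at h
    push_cast at h
    rw [inner_T_add_two hJ, ih₀ i j (by rw [lt_abs]; omega),
      ih₁ i j (by rw [lt_abs]; omega), ih₁ (i - 1) j (by rw [lt_abs]; omega),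
      ih₁ (i + 1) j (by rw [lt_abs]; omega)]
    ring

theorem inner_T_top
    (hJ : ∀ k : ℤ, J (ez k) = p k • ez (k - 1) + q k • ez k + p (k + 1) • ez (k + 1)) (n : ℕ) :
    ∀ i j : ℤ, j = i + n + 1 →
      ⟪aeval J (T (n + 1)) (ez i), ez j⟫ = ∏ k ∈ Finset.Icc (i + 1) j, p k := by
  induction n with
  | zero =>
    rintro i j rfl
    rw [inner_T_one hJ, if_neg (by omega), if_neg (by omega), if_pos (by simp)]
    simp
  | succ n ih =>
    intro i j h
    push_cast at h
    rw [inner_T_add_two hJ, inner_T_eq_zero hJ n i j (by rw [lt_abs]; omega),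
      inner_T_eq_zero hJ (n + 1) i j (by rw [lt_abs]; omega),
      inner_T_eq_zero hJ (n + 1) (i - 1) j (by rw [lt_abs]; omega),
      ih (i + 1) j (by omega), prod_Icc_int_left p (a := i + 1) (by omega)]
    ring

theorem inner_T_second
    (hJ : ∀ k : ℤ, J (ez k) = p k • ez (k - 1) + q k • ez k + p (k + 1) • ez (k + 1)) (n : ℕ) :
    ∀ i j : ℤ, j = i + n →
      ⟪aeval J (T (n + 1)) (ez i), ez j⟫
        = (∏ k ∈ Finset.Icc (i + 1) j, p k) * ∑ k ∈ Finset.Icc i j, q k := by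
  induction n with
  | zero =>
    rintro i j rfl
    rw [inner_T_one hJ, if_neg (by omega), if_pos (by simp), if_neg (by omega)]
    simp
  | succ n ih =>
    intro i j h
    push_cast at h
    rw [inner_T_add_two hJ, inner_T_eq_zero hJ n i j (by rw [lt_abs]; omega),
      inner_T_top hJ n i j (by omega),
      inner_T_eq_zero hJ (n + 1) (i - 1) j (by rw [lt_abs]; omega),
      ih (i + 1) j (by omega), prod_Icc_int_left p (a := i + 1) (by omega),
      sum_Icc_int_left q (a := i) (by omega)]
    ring

theorem inner_T_third
    (hJ : ∀ k : ℤ, J (ez k) = p k • ez (k - 1) + q k • ez k + p (k + 1) • ez (k + 1)) (n : ℕ) :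
    ∀ i j : ℤ, j = i + n →
      ⟪aeval J (T (n + 2)) (ez i), ez j⟫
        = (∏ k ∈ Finset.Icc (i + 1) j, p k)
          * ((∑ k ∈ Finset.Icc i (j + 1), (p k ^ 2 - 1))
            + ∑ k ∈ Finset.Icc i j, ∑ l ∈ Finset.Icc k j, q k * q l) := by
  induction n with
  | zero =>
    intro i j h
    obtain rfl : j = i := by simpa using h
    rw [inner_T_add_two hJ, inner_T_zero, sum_Icc_int_left _ (a := j) (b := j + 1) (by omega)]
    simp [inner_T_one hJ, show j - 1 - 1 ≠ j by omega, show j + 1 + 1 ≠ j by omega]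
    ring
  | succ n ih =>
    intro i j h
    push_cast at h
    rw [inner_T_add_two hJ, inner_T_top hJ n i j (by omega),
      inner_T_second hJ (n + 1) i j (by push_cast; omega),
      inner_T_top hJ (n + 1) (i - 1) j (by push_cast; omega),
      ih (i + 1) j (by omega), sub_add_cancel,
      prod_Icc_int_left p (a := i) (by omega),
      prod_Icc_int_left p (a := i + 1) (by omega),
      sum_Icc_int_left (fun k => p k ^ 2 - 1) (a := i) (by omega),
      sum_Icc_int_left (fun k => ∑ l ∈ Finset.Icc k j, q k * q l) (a := i) (by omega),
      ← Finset.mul_sum]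
    ring

end JacobiEntries

/-- The three extreme diagonals of `T_n(J)` for a two-sided Jacobi matrix `J`. -/
theorem stmt_11
    (p q : ℤ → ℝ) (hp : ∀ k, 0 < p k)
    (hpb : ∃ C, ∀ k, |p k| ≤ C) (hqb : ∃ C, ∀ k, |q k| ≤ C)
    (J : HZ →L[ℝ] HZ)
    (hJ : ∀ k : ℤ, J (ez k) = p k • ez (k - 1) + q k • ez k + p (k + 1) • ez (k + 1))
    (n : ℕ) (hn : 1 ≤ n) (i j : ℤ) :
    ((n : ℤ) < |i - j| → ⟪aeval J (T n) (ez i), ez j⟫ = 0)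
    ∧ ⟪aeval J (T n) (ez i), ez (i + n)⟫ = ∏ k ∈ Finset.Icc (i + 1) (i + n), p k
    ∧ ⟪aeval J (T n) (ez i), ez (i + n - 1)⟫
        = (∏ k ∈ Finset.Icc (i + 1) (i + n - 1), p k)
          * ∑ k ∈ Finset.Icc i (i + n - 1), q k
    ∧ (2 ≤ n → ⟪aeval J (T n) (ez i), ez (i + n - 2)⟫
        = (∏ k ∈ Finset.Icc (i + 1) (i + n - 2), p k)
          * ((∑ k ∈ Finset.Icc i (i + n - 1), (p k ^ 2 - 1))
            + ∑ k ∈ Finset.Icc i (i + n - 2),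
                ∑ l ∈ Finset.Icc k (i + n - 2), q k * q l)) := by
  obtain ⟨n, rfl⟩ : ∃ m, n = m + 1 := ⟨n - 1, by omega⟩
  refine ⟨inner_T_eq_zero hJ (n + 1) i j, inner_T_top hJ n i _ (by push_cast; ring),
    inner_T_second hJ n i _ (by push_cast; ring), fun h => ?_⟩
  obtain ⟨n, rfl⟩ : ∃ m, n = m + 1 := ⟨n - 1, by omega⟩
  have := inner_T_third hJ n i (i + ((n + 1 + 1 : ℕ) : ℤ) - 2) (by push_cast; ring)
  rwa [show i + ((n + 1 + 1 : ℕ) : ℤ) - 2 + 1 = i + ((n + 1 + 1 : ℕ) : ℤ) - 1 by ring] at this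

end
end

section
/- The function f is infinitely differentiable in a neighborhood of t = 0 and satisfies f(0) = 0, f'(0) = 0, and f''(0) = ⟨A(J₀) v, v⟩; equivalently, f(t) = (t²/2)·⟨A(J₀) v, v⟩ + O(t³) as t → 0. -/
open Polynomial MeasureTheory
open scoped ENNReal RealInnerProductSpace Real

noncomputable section

theorem inner_ez_left (k : ℤ) (w : HZ) : ⟪ez k, w⟫ = w k := by
  simp [ez, lp.inner_single_left]

theorem inner_ez_right (k : ℤ) (w : HZ) : ⟪w, ez k⟫ = w k := by
  rw [real_inner_comm, inner_ez_left]

theorem ez_apply (k j : ℤ) : (ez k : HZ) j = if k = j then 1 else 0 := by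
  by_cases h : k = j
  · subst h; simp [ez]
  · simp [ez, h]

theorem inner_ez_ez (k j : ℤ) : ⟪ez k, ez j⟫ = if k = j then (1 : ℝ) else 0 := by
  rw [inner_ez_right, ez_apply]

/-- Bounded operators on `ℓ²(ℤ)` agreeing on the standard basis are equal. -/
theorem ext_ez {S T : HZ →L[ℝ] HZ} (h : ∀ k, S (ez k) = T (ez k)) : S = T := by
  ext1 w
  have hw := lp.hasSum_single (E := fun _ : ℤ => ℝ) (p := 2) (by simp) w
  have e : ∀ k : ℤ, (lp.single 2 k (w k) : HZ) = w k • ez k := fun k => by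
    simp [ez, ← lp.single_smul]
  simp only [e] at hw
  have hS := hw.mapL S
  have hT := hw.mapL T
  simp only [map_smul, h] at hS hT
  exact hS.unique hT

section FiniteRank

variable {ι : Type*} (s : Finset ι) (c : ι → ℝ) (b d : ι → ℤ)

/-- The operator `∑ i ∈ s, c i · |e_{b i}⟩⟨e_{d i}|`. -/
def finiteRank : HZ →L[ℝ] HZ :=
  ∑ i ∈ s, c i • (innerSL ℝ (ez (d i))).smulRight (ez (b i))

/-- The functional `Z ↦ Tr (Z D)` for `D = finiteRank s c b d`. -/
def tracePairing : (HZ →L[ℝ] HZ) →L[ℝ] ℝ :=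
  ∑ i ∈ s, c i • (innerSL ℝ (ez (d i))).comp (ContinuousLinearMap.apply ℝ HZ (ez (b i)))

theorem finiteRank_apply (w : HZ) :
    finiteRank s c b d w = ∑ i ∈ s, (c i * w (d i)) • ez (b i) := by
  simp [finiteRank, inner_ez_left, smul_smul]

theorem tracePairing_apply (Z : HZ →L[ℝ] HZ) :
    tracePairing s c b d Z = ∑ i ∈ s, c i * ⟪Z (ez (b i)), ez (d i)⟫ := by
  simp [tracePairing, inner_ez_left, inner_ez_right]

/-- Cyclicity of the trace for finite rank operators. -/
theorem hasSum_trace_mul_finiteRank_mul (S T : HZ →L[ℝ] HZ) :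
    HasSum (fun k => ⟪(S * finiteRank s c b d * T) (ez k), ez k⟫)
      (tracePairing s c b d (T * S)) := by
  rw [tracePairing_apply]
  have h : ∀ k, ⟪(S * finiteRank s c b d * T) (ez k), ez k⟫
      = ∑ i ∈ s, c i * (T (ez k) (d i) * S (ez (b i)) k) := by
    intro k
    change ⟪S (finiteRank s c b d (T (ez k))), ez k⟫ = _
    rw [finiteRank_apply, map_sum, sum_inner]
    refine Finset.sum_congr rfl fun i _ => ?_
    rw [map_smul, real_inner_smul_left, inner_ez_right, mul_assoc]
  simp only [h]
  refine hasSum_sum fun i _ => HasSum.mul_left _ ?_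
  have := lp.hasSum_inner (𝕜 := ℝ) (ContinuousLinearMap.adjoint T (ez (d i))) (S (ez (b i)))
  rw [ContinuousLinearMap.adjoint_inner_left, real_inner_comm] at this
  have e : ∀ k, ⟪(ContinuousLinearMap.adjoint T (ez (d i))) k, S (ez (b i)) k⟫
      = T (ez k) (d i) * S (ez (b i)) k := fun k => by
    rw [← inner_ez_right k (ContinuousLinearMap.adjoint T (ez (d i))),
      ContinuousLinearMap.adjoint_inner_left, inner_ez_left]
    exact mul_comm _ _
  simp only [e] at this
  exact this

end FiniteRank

section Perturbation

theorem contDiff_aeval_add_smul (J D : HZ →L[ℝ] HZ) (P : ℝ[X]) :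
    ContDiff ℝ (⊤ : ℕ∞) fun t : ℝ => aeval (J + t • D) P := by
  induction P using Polynomial.induction_on' with
  | add p q hp hq => simpa using hp.add hq
  | monomial n a =>
    simp only [aeval_monomial]
    exact contDiff_const.mul (((contDiff_const.add (contDiff_id.smul contDiff_const))).pow n)

theorem pow_sub_pow_eq_sum {R : Type*} [Ring R] (S T : R) (n : ℕ) :
    S ^ n - T ^ n = ∑ i ∈ Finset.range n, S ^ i * (S - T) * T ^ (n - 1 - i) := by
  induction n with
  | zero => simp
  | succ n ih =>
    have h : S ^ (n + 1) - T ^ (n + 1) = (S ^ n - T ^ n) * T + S ^ n * (S - T) := by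
      rw [pow_succ, pow_succ]; noncomm_ring
    rw [h, ih, Finset.sum_range_succ, Finset.sum_mul]
    congr 1
    · refine Finset.sum_congr rfl fun i hi => ?_
      have := Finset.mem_range.1 hi
      rw [mul_assoc, ← pow_succ]
      congr 2
      omega
    · simp

variable {ι : Type*} (s : Finset ι) (c : ι → ℝ) (b d : ι → ℤ) (J : HZ →L[ℝ] HZ)

theorem exists_hasSum_trace_sub (P : ℝ[X]) (t : ℝ) :
    ∃ G : ℝ → (HZ →L[ℝ] HZ), Continuous G ∧
      G t = aeval (J + t • finiteRank s c b d) (derivative P) ∧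
      ∀ u : ℝ, HasSum (fun k => ⟪(aeval (J + u • finiteRank s c b d) P
        - aeval (J + t • finiteRank s c b d) P) (ez k), ez k⟫)
        ((u - t) * tracePairing s c b d (G u)) := by
  induction P using Polynomial.induction_on' with
  | add p q hp hq =>
    obtain ⟨G, hG, hGt, hGs⟩ := hp
    obtain ⟨H, hH, hHt, hHs⟩ := hq
    refine ⟨fun u => G u + H u, hG.add hH, by simp [hGt, hHt], fun u => ?_⟩
    convert (hGs u).add (hHs u) using 2 with k
    · rw [← inner_add_left, ← add_apply]
      congr 2
      simp only [map_add]
      abel_nf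
    · rw [map_add, mul_add]
  | monomial n a =>
    set D := finiteRank s c b d with hD
    refine ⟨fun u => a • ∑ i ∈ Finset.range n, (J + t • D) ^ (n - 1 - i) * (J + u • D) ^ i,
      by fun_prop, ?_, fun u => ?_⟩
    · have : ∀ i ∈ Finset.range n, (J + t • D) ^ (n - 1 - i) * (J + t • D) ^ i
          = (J + t • D) ^ (n - 1) := fun i hi => by
        have := Finset.mem_range.1 hi
        rw [← pow_add]; congr 1; omega
      simp only [derivative_monomial, aeval_monomial, Finset.sum_congr rfl this]
      simp [Algebra.algebraMap_eq_smul_one, mul_smul, Nat.cast_smul_eq_nsmul]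
    · have h1 : aeval (J + u • D) (monomial n a) - aeval (J + t • D) (monomial n a)
          = ∑ i ∈ Finset.range n, (a * (u - t)) •
            ((J + u • D) ^ i * D * (J + t • D) ^ (n - 1 - i)) := by
        have h2 : (J + u • D) - (J + t • D) = (u - t) • D := by
          rw [sub_smul]; abel
        simp only [aeval_monomial, Algebra.algebraMap_eq_smul_one, smul_mul_assoc, one_mul]
        rw [← smul_sub, pow_sub_pow_eq_sum, h2, Finset.smul_sum]
        refine Finset.sum_congr rfl fun i _ => ?_
        rw [mul_smul_comm, smul_mul_assoc, smul_smul]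
      rw [h1]
      have h3 := hasSum_sum (s := Finset.range n) fun i _ =>
        (hasSum_trace_mul_finiteRank_mul s c b d ((J + u • D) ^ i)
          ((J + t • D) ^ (n - 1 - i))).mul_left (a * (u - t))
      have h4 : ∀ k, ⟪(∑ i ∈ Finset.range n, (a * (u - t)) •
            ((J + u • D) ^ i * D * (J + t • D) ^ (n - 1 - i))) (ez k), ez k⟫
          = ∑ i ∈ Finset.range n, a * (u - t) *
            ⟪((J + u • D) ^ i * D * (J + t • D) ^ (n - 1 - i)) (ez k), ez k⟫ := fun k => by
        rw [sum_apply, sum_inner]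
        refine Finset.sum_congr rfl fun i _ => ?_
        rw [smul_apply, real_inner_smul_left]
      have h5 : (u - t) * tracePairing s c b d
            (a • ∑ i ∈ Finset.range n, (J + t • D) ^ (n - 1 - i) * (J + u • D) ^ i)
          = ∑ i ∈ Finset.range n, a * (u - t) * tracePairing s c b d
            ((J + t • D) ^ (n - 1 - i) * (J + u • D) ^ i) := by
        rw [map_smul, map_sum, smul_eq_mul, ← Finset.mul_sum]
        ring
      simpa only [h4, h5] using h3

theorem hasDerivAt_trace_sub (P : ℝ[X]) (t : ℝ) :
    HasDerivAt (fun u : ℝ => ∑' k, ⟪(aeval (J + u • finiteRank s c b d) P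
        - aeval J P) (ez k), ez k⟫)
      (tracePairing s c b d (aeval (J + t • finiteRank s c b d) (derivative P))) t := by
  obtain ⟨G, hG, hGt, hGs⟩ := exists_hasSum_trace_sub s c b d J P t
  obtain ⟨H, -, -, hHs⟩ := exists_hasSum_trace_sub s c b d J P 0
  simp only [zero_smul, add_zero] at hHs
  have key : ∀ u : ℝ, (∑' k, ⟪(aeval (J + u • finiteRank s c b d) P
        - aeval J P) (ez k), ez k⟫) = (∑' k, ⟪(aeval (J + t • finiteRank s c b d) P
        - aeval J P) (ez k), ez k⟫) + (u - t) * tracePairing s c b d (G u) := by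
    intro u
    have h := (hHs t).add (hGs u)
    rw [(hHs t).tsum_eq, ← h.tsum_eq]
    refine tsum_congr fun k => ?_
    rw [← inner_add_left, ← add_apply]
    congr 2
    abel_nf
  rw [← hGt, hasDerivAt_iff_tendsto_slope]
  have hc : Filter.Tendsto (fun u => tracePairing s c b d (G u)) (nhdsWithin t {t}ᶜ)
      (nhds (tracePairing s c b d (G t))) :=
    (((tracePairing s c b d).continuous.comp hG).tendsto t).mono_left nhdsWithin_le_nhds
  refine hc.congr' ?_
  filter_upwards [self_mem_nhdsWithin] with u hu
  have hu : u - t ≠ 0 := sub_ne_zero.2 hu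
  rw [slope_def_field, key u]
  field_simp
  ring

end Perturbation

theorem integral_cos_int_mul (n : ℤ) :
    ∫ θ in (0 : ℝ)..π, Real.cos (n * θ) = if n = 0 then π else 0 := by
  split_ifs with h
  · simp [h]
  · have hn : (n : ℝ) ≠ 0 := by exact_mod_cast h
    rw [intervalIntegral.integral_comp_mul_left _ hn]
    simp [Real.sin_int_mul_pi]

/-- Orthogonality of `S n` to constants with respect to the semicircle weight. -/
theorem integral_chebyshevS_mul_sqrt (n : ℕ) :
    ∫ x in (-2 : ℝ)..2, (Chebyshev.S ℝ n).eval x * √(4 - x ^ 2) = if n = 0 then 2 * π else 0 := by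
  have hsub := intervalIntegral.integral_comp_mul_deriv (a := π) (b := 0)
    (f := fun θ => 2 * Real.cos θ) (f' := fun θ => 2 * -Real.sin θ)
    (g := fun x => (Chebyshev.S ℝ n).eval x * √(4 - x ^ 2))
    (fun θ _ => (Real.hasDerivAt_cos θ).const_mul 2) (by fun_prop) (by fun_prop)
  simp only [Real.cos_pi, Real.cos_zero, mul_one, mul_neg, Function.comp_apply] at hsub
  rw [← hsub, intervalIntegral.integral_symm, ← intervalIntegral.integral_neg]
  simp only [neg_neg]
  have hcongr : ∫ θ in (0 : ℝ)..π, eval (2 * Real.cos θ) (Chebyshev.S ℝ n)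
        * √(4 - (2 * Real.cos θ) ^ 2) * (2 * Real.sin θ)
      = ∫ θ in (0 : ℝ)..π, (2 * Real.cos (n * θ) - 2 * Real.cos (((n + 2 : ℤ) : ℝ) * θ)) := by
    refine intervalIntegral.integral_congr fun θ hθ => ?_
    rw [Set.uIcc_of_le Real.pi_pos.le] at hθ
    have h0 : √(4 - (2 * Real.cos θ) ^ 2) = 2 * Real.sin θ := by
      rw [show 4 - (2 * Real.cos θ) ^ 2 = (2 * Real.sin θ) ^ 2 by
        nlinarith [Real.sin_sq_add_cos_sq θ]]
      exact Real.sqrt_sq (by have := Real.sin_nonneg_of_mem_Icc hθ; positivity)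
    have h1 := Polynomial.Chebyshev.S_two_mul_real_cos θ n
    have h2 : Real.cos (n * θ) - Real.cos (((n + 2 : ℤ) : ℝ) * θ)
        = 2 * (Real.sin ((n + 1) * θ) * Real.sin θ) := by
      have e1 : (n : ℝ) * θ = (n + 1) * θ - θ := by ring
      have e2 : ((n + 2 : ℤ) : ℝ) * θ = (n + 1) * θ + θ := by push_cast; ring
      rw [e1, e2, Real.cos_sub, Real.cos_add]; ring
    simp only [h0]
    push_cast at h1
    linear_combination 4 * Real.sin θ * h1 - 2 * h2
  rw [hcongr, intervalIntegral.integral_sub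
    (Continuous.intervalIntegrable (by fun_prop) _ _)
    (Continuous.intervalIntegrable (by fun_prop) _ _),
    intervalIntegral.integral_const_mul, intervalIntegral.integral_const_mul,
    integral_cos_int_mul]
  have h := integral_cos_int_mul n
  push_cast at h
  rw [h]
  have : (n : ℤ) + 2 ≠ 0 := by omega
  simp [this]

/-- The divided difference of a polynomial times a continuous weight is integrable. -/
theorem intervalIntegrable_dividedDifference (A : ℝ[X]) (z : ℝ) :
    IntervalIntegrable (fun x => (A.eval x - A.eval z) / (x - z) * √(4 - x ^ 2)) volume (-2) 2 := by
  obtain ⟨Q, hQ⟩ := X_sub_C_dvd_sub_C_eval (p := A) (a := z)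
  have hc : IntervalIntegrable (fun x => Q.eval x * √(4 - x ^ 2)) volume (-2) 2 :=
    Continuous.intervalIntegrable (by fun_prop) _ _
  refine hc.congr_ae ?_
  filter_upwards [compl_mem_ae_iff.2 (measure_singleton z)] with x hx
  have hx : x - z ≠ 0 := sub_ne_zero.2 hx
  have := congrArg (eval x) hQ
  simp only [eval_sub, eval_C, eval_mul, eval_X] at this
  rw [this]
  field_simp

/-- Functions of the second kind: the semicircle average of the divided difference. -/
def secondKind (A : ℝ[X]) (z : ℝ) : ℝ :=
  (1 / π) * ∫ x in (-2 : ℝ)..2, ((A.eval x - A.eval z) / (x - z)) * Real.sqrt (4 - x ^ 2)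

/-- The total mass of `A` against the (doubled) semicircle law. -/
def semicircleMass (A : ℝ[X]) : ℝ :=
  (1 / π) * ∫ x in (-2 : ℝ)..2, A.eval x * Real.sqrt (4 - x ^ 2)

theorem secondKind_add (A B : ℝ[X]) (z : ℝ) :
    secondKind (A + B) z = secondKind A z + secondKind B z := by
  rw [secondKind, secondKind, secondKind, ← mul_add, ← intervalIntegral.integral_add
    (intervalIntegrable_dividedDifference A z) (intervalIntegrable_dividedDifference B z)]
  congr 1
  refine intervalIntegral.integral_congr fun x _ => ?_
  simp only [eval_add]
  ring

theorem secondKind_smul (r : ℝ) (A : ℝ[X]) (z : ℝ) :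
    secondKind (r • A) z = r * secondKind A z := by
  rw [secondKind, secondKind, mul_left_comm, ← intervalIntegral.integral_const_mul r]
  congr 1
  refine intervalIntegral.integral_congr fun x _ => ?_
  simp only [eval_smul, smul_eq_mul]
  ring

theorem semicircleMass_add (A B : ℝ[X]) :
    semicircleMass (A + B) = semicircleMass A + semicircleMass B := by
  rw [semicircleMass, semicircleMass, semicircleMass, ← mul_add, ← intervalIntegral.integral_add
    (Continuous.intervalIntegrable (by fun_prop) _ _)
    (Continuous.intervalIntegrable (by fun_prop) _ _)]
  congr 1
  refine intervalIntegral.integral_congr fun x _ => ?_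
  simp only [eval_add]
  ring

theorem semicircleMass_smul (r : ℝ) (A : ℝ[X]) :
    semicircleMass (r • A) = r * semicircleMass A := by
  rw [semicircleMass, semicircleMass, mul_left_comm, ← intervalIntegral.integral_const_mul r]
  congr 1
  refine intervalIntegral.integral_congr fun x _ => ?_
  simp only [eval_smul, smul_eq_mul]
  ring

theorem semicircleMass_chebyshevS (n : ℕ) :
    semicircleMass (Chebyshev.S ℝ n) = if n = 0 then 2 else 0 := by
  rw [semicircleMass, integral_chebyshevS_mul_sqrt]
  split_ifs
  · field_simp
  · simp

theorem secondKind_X_mul (A : ℝ[X]) (z : ℝ) :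
    secondKind (X * A) z = semicircleMass A + z * secondKind A z := by
  rw [semicircleMass, secondKind, secondKind, mul_left_comm, ← mul_add,
    ← intervalIntegral.integral_const_mul z, ← intervalIntegral.integral_add
    (Continuous.intervalIntegrable (by fun_prop) _ _)
    ((intervalIntegrable_dividedDifference A z).const_mul z)]
  congr 1
  refine intervalIntegral.integral_congr_ae ?_
  filter_upwards [compl_mem_ae_iff.2 (measure_singleton z)] with x hx _
  have hx : x - z ≠ 0 := sub_ne_zero.2 hx
  simp only [eval_mul, eval_X]
  field_simp
  ring

theorem secondKind_chebyshevS (n : ℕ) (z : ℝ) :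
    secondKind (Chebyshev.S ℝ n) z = 2 * (Chebyshev.S ℝ (n - 1)).eval z := by
  induction n using Nat.twoStepInduction with
  | zero => simp [secondKind]
  | one =>
    have h := secondKind_X_mul 1 z
    have h1 := semicircleMass_chebyshevS 0
    have h2 : secondKind 1 z = 0 := by simp [secondKind]
    simp only [Nat.cast_zero, Chebyshev.S_zero, if_true] at h1
    simpa [h1, h2] using h
  | more n ih1 ih2 =>
    have e : Chebyshev.S ℝ ((n + 2 : ℕ) : ℤ)
        = X * Chebyshev.S ℝ ((n + 1 : ℕ) : ℤ) + (-1 : ℝ) • Chebyshev.S ℝ n := by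
      have := Chebyshev.S_add_two ℝ n
      push_cast
      rw [this]; simp [sub_eq_add_neg]
    rw [e, secondKind_add, secondKind_smul, secondKind_X_mul, ih1, ih2,
      semicircleMass_chebyshevS]
    have e2 := Chebyshev.S_add_two ℝ ((n : ℤ) - 1)
    have e3 : ((n + 2 : ℕ) : ℤ) - 1 = (n : ℤ) - 1 + 2 := by push_cast; ring
    have e4 : ((n + 1 : ℕ) : ℤ) - 1 = (n : ℤ) - 1 + 1 := by push_cast; ring
    rw [e3, e2, e4]
    simp
    ring

/-- The Chebyshev polynomials `S n` span all polynomials. -/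
theorem induction_on_chebyshevS {p : ℝ[X] → Prop} (A : ℝ[X])
    (hS : ∀ n : ℕ, p (Chebyshev.S ℝ n)) (hadd : ∀ P Q, p P → p Q → p (P + Q))
    (hsmul : ∀ (r : ℝ) P, p P → p (r • P)) : p A := by
  have h : ∀ n k : ℕ, p (X ^ k * Chebyshev.S ℝ n) := by
    intro n k
    induction k generalizing n with
    | zero => simpa using hS n
    | succ k ih =>
      rcases n with _ | n
      · have := ih 1
        simpa [pow_succ] using this
      · have e : X ^ (k + 1) * Chebyshev.S ℝ ((n + 1 : ℕ) : ℤ)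
            = X ^ k * Chebyshev.S ℝ ((n + 2 : ℕ) : ℤ) + (1 : ℝ) • (X ^ k * Chebyshev.S ℝ n) := by
          have := Chebyshev.S_add_two ℝ n
          push_cast
          rw [this, one_smul]; ring
        rw [e]
        exact hadd _ _ (ih _) (hsmul _ _ (ih _))
  induction A using Polynomial.induction_on' with
  | add P Q hP hQ => exact hadd _ _ hP hQ
  | monomial n r =>
    rw [← C_mul_X_pow_eq_monomial, ← smul_eq_C_mul]
    exact hsmul _ _ (by simpa using h 0 n)

/-- The coefficients of the Laurent polynomial `z ^ n + z ^ (n - 2) + ⋯ + z ^ (-n)`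
where `N = n + 1`, as a function of the absolute value of the exponent. -/
def chebyshevCoeff (N e : ℕ) : ℝ := if e < N ∧ (N + e) % 2 = 1 then 1 else 0

theorem chebyshevCoeff_add_two (N e : ℕ) :
    chebyshevCoeff (N + 1) (e + 2) + chebyshevCoeff (N + 1) e - chebyshevCoeff N (e + 1)
      = chebyshevCoeff (N + 2) (e + 1) := by
  simp only [chebyshevCoeff]
  split_ifs <;> first | omega | norm_num

theorem chebyshevCoeff_boundary (N e : ℕ) :
    2 * chebyshevCoeff (N + 1) (e + 1) + (if e = N + 1 then 1 else 0) - chebyshevCoeff N e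
      = chebyshevCoeff (N + 2) e := by
  simp only [chebyshevCoeff]
  split_ifs <;> first | omega | norm_num

theorem chebyshevCoeff_natAbs_recurrence (N : ℕ) (p q : ℤ) :
    chebyshevCoeff (N + 1) (p.natAbs + (q + 1).natAbs)
        + chebyshevCoeff (N + 1) (p.natAbs + (q - 1).natAbs)
        + (if q = 0 then 1 else 0)
          * ((if p = N + 1 then 1 else 0) + (if p = -(N + 1) then 1 else 0))
        - chebyshevCoeff N (p.natAbs + q.natAbs)
      = chebyshevCoeff (N + 2) (p.natAbs + q.natAbs) := by
  rcases lt_trichotomy q 0 with hq | rfl | hq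
  · obtain ⟨r, rfl⟩ : ∃ r : ℕ, q = -(r + 1) := ⟨q.natAbs - 1, by omega⟩
    rw [← show p.natAbs + r + 1 = p.natAbs + (-(r + 1 : ℤ)).natAbs by omega,
      ← chebyshevCoeff_add_two, if_neg (by omega),
      show p.natAbs + (-(r + 1 : ℤ) + 1).natAbs = p.natAbs + r by omega,
      show p.natAbs + (-(r + 1 : ℤ) - 1).natAbs = p.natAbs + r + 2 by omega]
    ring
  · have h : (if p = N + 1 then (1 : ℝ) else 0) + (if p = -(N + 1) then 1 else 0)
        = if p.natAbs = N + 1 then 1 else 0 := by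
      split_ifs <;> first | omega | norm_num
    rw [h]
    simp only [zero_add, zero_sub, Int.natAbs_zero, Int.natAbs_neg, Int.natAbs_one, add_zero,
      if_true, one_mul]
    rw [← chebyshevCoeff_boundary]
    ring
  · obtain ⟨r, rfl⟩ : ∃ r : ℕ, q = r + 1 := ⟨q.natAbs - 1, by omega⟩
    rw [← show p.natAbs + r + 1 = p.natAbs + (r + 1 : ℤ).natAbs by omega,
      ← chebyshevCoeff_add_two, if_neg (by omega),
      show p.natAbs + (r + 1 + 1 : ℤ).natAbs = p.natAbs + r + 2 by omega,
      show p.natAbs + (r + 1 - 1 : ℤ).natAbs = p.natAbs + r by omega]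
    ring

theorem inner_one_ez (x y : ℤ) :
    ⟪(1 : HZ →L[ℝ] HZ) (ez y), ez x⟫ = if y = x then (1 : ℝ) else 0 :=
  inner_ez_ez y x

section MatrixEntries

variable {J₀ : HZ →L[ℝ] HZ}

theorem inner_mul_free
    (hJ₀ : ∀ k : ℤ, J₀ (ez k) = ez (k - 1) + ez (k + 1)) (Z : HZ →L[ℝ] HZ) (x y : ℤ) :
    ⟪(Z * J₀) (ez y), ez x⟫ = ⟪Z (ez (y - 1)), ez x⟫ + ⟪Z (ez (y + 1)), ez x⟫ := by
  rw [← inner_add_left, ← map_add, ← hJ₀]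
  rfl

theorem inner_aeval_chebyshevS
    (hJ₀ : ∀ k : ℤ, J₀ (ez k) = ez (k - 1) + ez (k + 1)) (n : ℕ) (x y : ℤ) :
    ⟪aeval J₀ (Chebyshev.S ℝ n) (ez y), ez x⟫ = chebyshevCoeff (n + 1) (x - y).natAbs := by
  induction n using Nat.twoStepInduction generalizing y with
  | zero =>
    simp only [Nat.cast_zero, Chebyshev.S_zero, map_one, inner_one_ez, chebyshevCoeff]
    split_ifs <;> first | omega | rfl
  | one =>
    simp only [Nat.cast_one, Chebyshev.S_one, aeval_X, hJ₀, inner_add_left, inner_ez_ez,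
      chebyshevCoeff]
    split_ifs <;> first | omega | norm_num
  | more n ih1 ih2 =>
    have e : Chebyshev.S ℝ ((n + 2 : ℕ) : ℤ)
        = Chebyshev.S ℝ ((n + 1 : ℕ) : ℤ) * X - Chebyshev.S ℝ n := by
      have := Chebyshev.S_add_two ℝ n
      push_cast
      rw [this, mul_comm]
    rw [e, map_sub, map_mul, aeval_X, sub_apply, inner_sub_left, inner_mul_free hJ₀, ih1, ih2, ih2]
    simp only [chebyshevCoeff]
    split_ifs <;> first | omega | norm_num

theorem inner_aeval_chebyshevC
    (hJ₀ : ∀ k : ℤ, J₀ (ez k) = ez (k - 1) + ez (k + 1)) (n : ℕ) (x y : ℤ) :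
    ⟪aeval J₀ (Chebyshev.C ℝ n) (ez y), ez x⟫
      = (if x = y + n then 1 else 0) + (if x = y - n then 1 else 0) := by
  induction n using Nat.twoStepInduction generalizing y with
  | zero =>
    have : aeval J₀ (2 : ℝ[X]) = (2 : ℝ) • (1 : HZ →L[ℝ] HZ) := by
      rw [← map_ofNat C 2, aeval_C, Algebra.algebraMap_eq_smul_one]
    simp only [Nat.cast_zero, Chebyshev.C_zero, this, smul_apply, real_inner_smul_left,
      inner_one_ez]
    split_ifs <;> first | omega | norm_num
  | one =>
    simp only [Nat.cast_one, Chebyshev.C_one, aeval_X, hJ₀, inner_add_left, inner_ez_ez]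
    split_ifs <;> first | omega | norm_num
  | more n ih1 ih2 =>
    have e : Chebyshev.C ℝ ((n + 2 : ℕ) : ℤ)
        = Chebyshev.C ℝ ((n + 1 : ℕ) : ℤ) * X - Chebyshev.C ℝ n := by
      have := Chebyshev.C_add_two ℝ n
      push_cast
      rw [this, mul_comm]
    rw [e, map_sub, map_mul, aeval_X, sub_apply, inner_sub_left, inner_mul_free hJ₀, ih1, ih2, ih2]
    split_ifs <;> first | omega | norm_num

variable {ι : Type*} (s : Finset ι) (c : ι → ℝ) (b d : ι → ℤ)

/-- The directional derivative of `C n` at the free Jacobi matrix has explicit matrix entries. -/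
theorem exists_hasDerivAt_aeval_chebyshevC
    (hJ₀ : ∀ k : ℤ, J₀ (ez k) = ez (k - 1) + ez (k + 1)) (n : ℕ) :
    ∃ Z : HZ →L[ℝ] HZ,
      HasDerivAt (fun t : ℝ => aeval (J₀ + t • finiteRank s c b d) (Chebyshev.C ℝ n)) Z 0 ∧
      ∀ x y, ⟪Z (ez y), ez x⟫
        = ∑ i ∈ s, c i * chebyshevCoeff n ((x - b i).natAbs + (d i - y).natAbs) := by
  set D := finiteRank s c b d with hD
  have hlin : HasDerivAt (fun t : ℝ => J₀ + t • D) D 0 := by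
    simpa using ((hasDerivAt_id (0 : ℝ)).smul_const D).const_add J₀
  have hDe : ∀ (Z : HZ →L[ℝ] HZ) (x y : ℤ), ⟪(Z * D) (ez y), ez x⟫
      = ∑ i ∈ s, c i * ((if y = d i then 1 else 0) * ⟪Z (ez (b i)), ez x⟫) := by
    intro Z x y
    change ⟪Z (D (ez y)), ez x⟫ = _
    rw [hD, finiteRank_apply, map_sum, sum_inner]
    refine Finset.sum_congr rfl fun i _ => ?_
    rw [map_smul, real_inner_smul_left, ez_apply, mul_assoc]
  induction n using Nat.twoStepInduction with
  | zero =>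
    refine ⟨0, ?_, fun x y => by simp [chebyshevCoeff]⟩
    have : ∀ T : HZ →L[ℝ] HZ, aeval T (2 : ℝ[X]) = (2 : ℝ) • (1 : HZ →L[ℝ] HZ) := fun T => by
      rw [← map_ofNat C 2, aeval_C, Algebra.algebraMap_eq_smul_one]
    simp only [Nat.cast_zero, Chebyshev.C_zero, this]
    exact hasDerivAt_const _ _
  | one =>
    refine ⟨D, by simpa using hlin, fun x y => ?_⟩
    rw [← one_mul D, hDe]
    refine Finset.sum_congr rfl fun i _ => ?_
    simp only [inner_one_ez, chebyshevCoeff]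
    congr 1
    split_ifs <;> first | omega | norm_num
  | more n ih1 ih2 =>
    obtain ⟨Z₁, h1, e1⟩ := ih1
    obtain ⟨Z₂, h2, e2⟩ := ih2
    have e : Chebyshev.C ℝ ((n + 2 : ℕ) : ℤ)
        = Chebyshev.C ℝ ((n + 1 : ℕ) : ℤ) * X - Chebyshev.C ℝ n := by
      have := Chebyshev.C_add_two ℝ n
      push_cast
      rw [this, mul_comm]
    refine ⟨Z₂ * J₀ + aeval J₀ (Chebyshev.C ℝ ((n + 1 : ℕ) : ℤ)) * D - Z₁, ?_, fun x y => ?_⟩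
    · simp only [e, map_sub, map_mul, aeval_X]
      have h := (h2.mul hlin).sub h1
      simp only [zero_smul, add_zero] at h
      exact h
    · rw [sub_apply, add_apply, inner_sub_left, inner_add_left, inner_mul_free hJ₀, hDe, e1, e2, e2,
        ← Finset.sum_add_distrib, ← Finset.sum_add_distrib, ← Finset.sum_sub_distrib]
      refine Finset.sum_congr rfl fun i _ => ?_
      rw [inner_aeval_chebyshevC hJ₀, ← mul_add, ← mul_add, ← mul_sub]
      congr 1
      rw [← chebyshevCoeff_natAbs_recurrence]
      have e1 : d i - (y - 1) = d i - y + 1 := by ring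
      have e2 : d i - (y + 1) = d i - y - 1 := by ring
      have e3 : y = d i ↔ d i - y = 0 := by omega
      have e4 : x = b i + ((n + 1 : ℕ) : ℤ) ↔ x - b i = n + 1 := by omega
      have e5 : x = b i - ((n + 1 : ℕ) : ℤ) ↔ x - b i = -(n + 1) := by omega
      simp only [e1, e2, e3, e4, e5]

end MatrixEntries

section JacobiPerturbation

variable (K : Finset ℤ) (dp dq : ℤ → ℝ)

/-- The values of the nonzero matrix entries of a symmetric tridiagonal matrix. -/
def tridiagValue (i : ℤ × Fin 3) : ℝ := ![dq i.1, dp i.1, dp i.1] i.2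

/-- The rows of the nonzero matrix entries of a symmetric tridiagonal matrix. -/
def tridiagRow (i : ℤ × Fin 3) : ℤ := ![i.1, i.1 - 1, i.1] i.2

/-- The columns of the nonzero matrix entries of a symmetric tridiagonal matrix. -/
def tridiagCol (i : ℤ × Fin 3) : ℤ := ![i.1, i.1, i.1 - 1] i.2

theorem sum_tridiag {M : Type*} [AddCommMonoid M] (g : ℝ → ℤ → ℤ → M) :
    ∑ i ∈ K ×ˢ Finset.univ, g (tridiagValue dp dq i) (tridiagRow i) (tridiagCol i)
      = ∑ k ∈ K, (g (dq k) k k + g (dp k) (k - 1) k + g (dp k) k (k - 1)) := by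
  simp [Finset.sum_product, Fin.sum_univ_three, tridiagValue, tridiagRow, tridiagCol]

/-- The tridiagonal operator with diagonal `dq` and off-diagonal `dp`, restricted to `K`. -/
abbrev tridiag : HZ →L[ℝ] HZ :=
  finiteRank (K ×ˢ Finset.univ) (tridiagValue dp dq) tridiagRow tridiagCol

/-- The trace against `tridiag K dp dq`. -/
abbrev tridiagPairing : (HZ →L[ℝ] HZ) →L[ℝ] ℝ :=
  tracePairing (K ×ˢ Finset.univ) (tridiagValue dp dq) tridiagRow tridiagCol

theorem tridiagPairing_apply (Z : HZ →L[ℝ] HZ) :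
    tridiagPairing K dp dq Z = ∑ l ∈ K, (dq l * ⟪Z (ez l), ez l⟫
      + dp l * ⟪Z (ez (l - 1)), ez l⟫ + dp l * ⟪Z (ez l), ez (l - 1)⟫) := by
  rw [tracePairing_apply]
  exact sum_tridiag K dp dq fun r x y => r * ⟪Z (ez x), ez y⟫

variable {K dp dq}

theorem tridiag_ez (hp : ∀ k ∉ K, dp k = 0) (hq : ∀ k ∉ K, dq k = 0) (k : ℤ) :
    tridiag K dp dq (ez k) = dp k • ez (k - 1) + dq k • ez k + dp (k + 1) • ez (k + 1) := by
  rw [finiteRank_apply, sum_tridiag K dp dq fun r x y => (r * (ez k : HZ) y) • ez x]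
  simp only [ez_apply, Finset.sum_add_distrib]
  have h : ∀ l, (k = l - 1) ↔ (k + 1 = l) := fun l => by omega
  simp only [h, mul_ite, mul_one, mul_zero, ite_smul, zero_smul, Finset.sum_ite_eq]
  have e1 : ∀ w : HZ, (if k ∈ K then dq k • w else 0) = dq k • w := fun w => by
    split_ifs with hk <;> simp [hq, hk]
  have e2 : ∀ w : HZ, ∀ k, (if k ∈ K then dp k • w else 0) = dp k • w := fun w k => by
    split_ifs with hk <;> simp [hp, hk]
  rw [e1, e2, e2]
  abel

theorem eq_sum_ez (hp : ∀ k ∉ K, dp k = 0) (hq : ∀ k ∉ K, dq k = 0) {v : HZ}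
    (hv : ∀ k : ℤ, ⟪v, ez (2 * k)⟫ = dq k ∧ ⟪v, ez (2 * k + 1)⟫ = 2 * dp (k + 1)) :
    v = ∑ k ∈ K, (dq k • ez (2 * k) + (2 * dp k) • ez (2 * k - 1)) := by
  ext j
  rw [← inner_ez_right, ← inner_ez_right, sum_inner]
  simp only [inner_add_left, real_inner_smul_left, inner_ez_ez]
  rcases Int.even_or_odd' j with ⟨k, rfl | rfl⟩
  · have h1 : ∀ l, (2 * l = 2 * k) ↔ (k = l) := fun l => by omega
    have h2 : ∀ l, (2 * l - 1 = 2 * k) ↔ False := fun l => iff_false_intro (by omega)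
    rw [(hv k).1]
    simp only [h1, h2, if_false, mul_ite, mul_one, mul_zero, add_zero, Finset.sum_ite_eq]
    split_ifs with hk <;> simp [hq, hk]
  · have h1 : ∀ l, (2 * l = 2 * k + 1) ↔ False := fun l => iff_false_intro (by omega)
    have h2 : ∀ l, (2 * l - 1 = 2 * k + 1) ↔ (k + 1 = l) := fun l => by omega
    rw [(hv k).2]
    simp only [h1, h2, if_false, mul_ite, mul_one, mul_zero, zero_add, Finset.sum_ite_eq]
    split_ifs with hk <;> simp [hp, hk]

variable {J₀ : HZ →L[ℝ] HZ}

theorem tridiagPairing_aeval_chebyshevC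
    (hJ₀ : ∀ k : ℤ, J₀ (ez k) = ez (k - 1) + ez (k + 1)) (n : ℕ) :
    tridiagPairing K dp dq (aeval J₀ (Chebyshev.C ℝ ((n + 1 : ℕ) : ℤ)))
      = semicircleMass (Chebyshev.S ℝ n) * ∑ k ∈ K, dp k := by
  rw [tridiagPairing_apply, Finset.mul_sum, semicircleMass_chebyshevS]
  refine Finset.sum_congr rfl fun l _ => ?_
  simp only [inner_aeval_chebyshevC hJ₀]
  rcases n with _ | n
  · rw [if_neg (by omega), if_neg (by omega), if_pos (by omega), if_neg (by omega),
      if_neg (by omega), if_pos (by omega), if_pos rfl]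
    ring
  · rw [if_neg (by omega), if_neg (by omega), if_neg (by omega), if_neg (by omega),
      if_neg (by omega), if_neg (by omega), if_neg (by omega)]
    ring

theorem inner_aeval_chebyshevS_sum
    (hJ₀ : ∀ k : ℤ, J₀ (ez k) = ez (k - 1) + ez (k + 1)) (n : ℕ) :
    ⟪aeval J₀ (Chebyshev.S ℝ n) (∑ k ∈ K, (dq k • ez (2 * k) + (2 * dp k) • ez (2 * k - 1))),
        ∑ l ∈ K, (dq l • ez (2 * l) + (2 * dp l) • ez (2 * l - 1))⟫
      = ∑ l ∈ K, ∑ k ∈ K,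
        (dq l * dq k * chebyshevCoeff (n + 1) (2 * (l - k)).natAbs
          + 2 * dq l * dp k * chebyshevCoeff (n + 1) (2 * (l - k) + 1).natAbs
          + 2 * dp l * dq k * chebyshevCoeff (n + 1) (2 * (l - k) - 1).natAbs
          + 4 * dp l * dp k * chebyshevCoeff (n + 1) (2 * (l - k)).natAbs) := by
  rw [inner_sum]
  refine Finset.sum_congr rfl fun l _ => ?_
  rw [map_sum, sum_inner]
  refine Finset.sum_congr rfl fun k _ => ?_
  simp only [map_add, map_smul, inner_add_left, inner_add_right, real_inner_smul_left,
    real_inner_smul_right, inner_aeval_chebyshevS hJ₀]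
  rw [show 2 * l - 2 * k = 2 * (l - k) by ring, show 2 * l - (2 * k - 1) = 2 * (l - k) + 1 by ring,
    show 2 * l - 1 - 2 * k = 2 * (l - k) - 1 by ring,
    show 2 * l - 1 - (2 * k - 1) = 2 * (l - k) by ring]
  ring

theorem tridiagPairing_eq_inner_chebyshevS
    (hJ₀ : ∀ k : ℤ, J₀ (ez k) = ez (k - 1) + ez (k + 1)) (n : ℕ) {Z : HZ →L[ℝ] HZ}
    (hZ : ∀ x y, ⟪Z (ez y), ez x⟫ = ∑ i ∈ K ×ˢ Finset.univ, tridiagValue dp dq i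
      * chebyshevCoeff (n + 1) ((x - tridiagRow i).natAbs + (tridiagCol i - y).natAbs)) :
    tridiagPairing K dp dq Z + semicircleMass (Chebyshev.S ℝ n) * ∑ k ∈ K, dp k ^ 2
      = ⟪aeval J₀ (Chebyshev.S ℝ n) (∑ k ∈ K, (dq k • ez (2 * k) + (2 * dp k) • ez (2 * k - 1))),
        ∑ l ∈ K, (dq l • ez (2 * l) + (2 * dp l) • ez (2 * l - 1))⟫ := by
  have hZ' : ∀ x y, ⟪Z (ez y), ez x⟫ = _ := fun x y => (hZ x y).trans
    (sum_tridiag K dp dq fun r b d =>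
      r * chebyshevCoeff (n + 1) ((x - b).natAbs + (d - y).natAbs))
  rw [inner_aeval_chebyshevS_sum hJ₀, tridiagPairing_apply, Finset.mul_sum,
    ← Finset.sum_add_distrib]
  refine Finset.sum_congr rfl fun l hl => ?_
  have hdiag : semicircleMass (Chebyshev.S ℝ n) * dp l ^ 2
      = ∑ k ∈ K, if l = k then semicircleMass (Chebyshev.S ℝ n) * (dp l * dp k) else 0 := by
    rw [Finset.sum_ite_eq, if_pos hl, sq]
  rw [hdiag, hZ', hZ', hZ', Finset.mul_sum, Finset.mul_sum, Finset.mul_sum,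
    ← Finset.sum_add_distrib, ← Finset.sum_add_distrib, ← Finset.sum_add_distrib]
  refine Finset.sum_congr rfl fun k _ => ?_
  obtain ⟨r, rfl⟩ : ∃ r, l = k + r := ⟨l - k, by ring⟩
  rw [show (k + r - k).natAbs + (k - (k + r)).natAbs = (2 * (k + r - k)).natAbs by omega,
    show (k + r - (k - 1)).natAbs + (k - (k + r)).natAbs = (2 * (k + r - k) + 1).natAbs by omega,
    show (k + r - k).natAbs + (k - 1 - (k + r)).natAbs = (2 * (k + r - k) + 1).natAbs by omega,
    show (k + r - k).natAbs + (k - (k + r - 1)).natAbs = (2 * (k + r - k) - 1).natAbs by omega,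
    show (k + r - k).natAbs + (k - 1 - (k + r - 1)).natAbs = (2 * (k + r - k)).natAbs by omega,
    show (k + r - 1 - k).natAbs + (k - (k + r)).natAbs = (2 * (k + r - k) - 1).natAbs by omega,
    show (k + r - 1 - (k - 1)).natAbs + (k - (k + r)).natAbs = (2 * (k + r - k)).natAbs by omega]
  by_cases hr : r = 0
  · subst hr
    have hmass : semicircleMass (Chebyshev.S ℝ n) + 2 * chebyshevCoeff (n + 1) 2
        = 2 * chebyshevCoeff (n + 1) 0 := by
      rw [semicircleMass_chebyshevS]
      simp only [chebyshevCoeff]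
      split_ifs <;> first | omega | norm_num
    rw [if_pos (by omega),
      show (k + 0 - (k - 1)).natAbs + (k - (k + 0 - 1)).natAbs = 2 by omega,
      show (k + 0 - 1 - k).natAbs + (k - 1 - (k + 0)).natAbs = 2 by omega,
      show (2 * (k + 0 - k)).natAbs = 0 by omega, add_zero]
    linear_combination dp k * dp k * hmass
  · rw [if_neg (by omega),
      show (k + r - (k - 1)).natAbs + (k - (k + r - 1)).natAbs = (2 * (k + r - k)).natAbs by omega,
      show (k + r - 1 - k).natAbs + (k - 1 - (k + r)).natAbs = (2 * (k + r - k)).natAbs by omega]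
    ring

/-- The first and second variation of the trace functional, for all polynomials `A`. -/
theorem exists_variation
    (hJ₀ : ∀ k : ℤ, J₀ (ez k) = ez (k - 1) + ez (k + 1)) (A : ℝ[X]) :
    ∃ (Ψ : ℝ[X]) (Z : HZ →L[ℝ] HZ),
      (∀ z, Ψ.eval z = z * A.eval z - secondKind A z) ∧
      HasDerivAt (fun t : ℝ => aeval (J₀ + t • tridiag K dp dq) Ψ) Z 0 ∧
      tridiagPairing K dp dq (aeval J₀ Ψ) = semicircleMass A * ∑ k ∈ K, dp k ∧
      tridiagPairing K dp dq Z + semicircleMass A * ∑ k ∈ K, dp k ^ 2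
        = ⟪aeval J₀ A (∑ k ∈ K, (dq k • ez (2 * k) + (2 * dp k) • ez (2 * k - 1))),
          ∑ l ∈ K, (dq l • ez (2 * l) + (2 * dp l) • ez (2 * l - 1))⟫ := by
  induction A using induction_on_chebyshevS with
  | hS n =>
    obtain ⟨Z, hZ, hZe⟩ := exists_hasDerivAt_aeval_chebyshevC (K ×ˢ Finset.univ)
      (tridiagValue dp dq) tridiagRow tridiagCol hJ₀ (n + 1)
    refine ⟨_, Z, fun z => ?_, hZ, tridiagPairing_aeval_chebyshevC hJ₀ n,
      tridiagPairing_eq_inner_chebyshevS hJ₀ n hZe⟩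
    rw [secondKind_chebyshevS, Nat.cast_add_one, Chebyshev.C_eq_S_sub_X_mul_S,
      Chebyshev.S_add_one, add_sub_cancel_right]
    simp only [eval_sub, eval_mul, eval_X, eval_ofNat]
    ring
  | hadd P Q hP hQ =>
    obtain ⟨Ψ₁, Z₁, h1, d1, f1, s1⟩ := hP
    obtain ⟨Ψ₂, Z₂, h2, d2, f2, s2⟩ := hQ
    refine ⟨Ψ₁ + Ψ₂, Z₁ + Z₂, fun z => ?_, ?_, ?_, ?_⟩
    · rw [secondKind_add, eval_add, eval_add, h1, h2]; ring
    · simp only [map_add]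
      exact d1.add d2
    · rw [map_add, map_add, f1, f2, semicircleMass_add]; ring
    · rw [map_add, map_add, semicircleMass_add, add_apply, inner_add_left, ← s1, ← s2]; ring
  | hsmul r P hP =>
    obtain ⟨Ψ, Z, h, d, f, s⟩ := hP
    refine ⟨r • Ψ, r • Z, fun z => ?_, ?_, ?_, ?_⟩
    · rw [secondKind_smul, eval_smul, eval_smul, h, smul_eq_mul, smul_eq_mul]; ring
    · simp only [map_smul]
      exact d.const_smul r
    · rw [map_smul, map_smul, f, semicircleMass_smul, smul_eq_mul]; ring
    · rw [map_smul, map_smul, semicircleMass_smul, smul_apply, real_inner_smul_left, ← s,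
        smul_eq_mul]; ring

end JacobiPerturbation

/-- The quadratic expansion of the Killip–Simon functional about the free Jacobi
matrix: `f` is smooth near `0`, `f(0) = 0`, `f'(0) = 0`, `f''(0) = ⟨A(J₀)v, v⟩`. -/
theorem stmt_14
    -- the polynomial `A` and the data built from it
    (A : Polynomial ℝ) (m : ℕ) (hdeg : A.natDegree = m) (hA : ∀ x : ℝ, 0 ≤ A.eval x)
    (a : ℝ) (ha : a = (1 / π) * ∫ x in (-2 : ℝ)..2, A.eval x * Real.sqrt (4 - x ^ 2))
    (Φ : Polynomial ℝ) (hΦdeg : Φ.natDegree = m + 2)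
    (hΦ : ∀ z : ℝ, (derivative Φ).eval z
      = z * A.eval z
        - (1 / π) * ∫ x in (-2 : ℝ)..2,
            ((A.eval x - A.eval z) / (x - z)) * Real.sqrt (4 - x ^ 2))
    -- the perturbation directions
    (dp dq : ℤ → ℝ)
    (hdp : (Function.support dp).Finite) (hdq : (Function.support dq).Finite)
    -- the family of Jacobi matrices `J_t` and the free Jacobi matrix `J₀`
    (Jt : ℝ → (HZ →L[ℝ] HZ)) (J₀ : HZ →L[ℝ] HZ)
    (hJt : ∀ (t : ℝ) (k : ℤ), Jt t (ez k)
      = (1 + t * dp k) • ez (k - 1) + (t * dq k) • ez k + (1 + t * dp (k + 1)) • ez (k + 1))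
    (hJ₀ : ∀ k : ℤ, J₀ (ez k) = ez (k - 1) + ez (k + 1))
    -- the functional `f`
    (f : ℝ → ℝ)
    (hf : ∀ t : ℝ, f t
      = -a * (∑' k : ℤ, Real.log (1 + t * dp k))
        + ∑' k : ℤ, ⟪(aeval (Jt t) Φ - aeval J₀ Φ) (ez k), ez k⟫)
    -- the vector `v` with `v_{2k} = dq_k`, `v_{2k+1} = 2 dp_{k+1}`
    (v : HZ)
    (hv : ∀ k : ℤ, ⟪v, ez (2 * k)⟫ = dq k ∧ ⟪v, ez (2 * k + 1)⟫ = 2 * dp (k + 1)) :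
    ContDiffAt ℝ (⊤ : ℕ∞) f 0 ∧ f 0 = 0 ∧ deriv f 0 = 0
      ∧ deriv (deriv f) 0 = ⟪aeval J₀ A v, v⟫ := by
  obtain ⟨K, hK⟩ : ∃ K : Finset ℤ, ∀ k ∉ K, dp k = 0 ∧ dq k = 0 := by
    refine ⟨hdp.toFinset ∪ hdq.toFinset, fun k hk => ?_⟩
    simpa [not_or] using hk
  have hp : ∀ k ∉ K, dp k = 0 := fun k hk => (hK k hk).1
  have hq : ∀ k ∉ K, dq k = 0 := fun k hk => (hK k hk).2
  have hJ : ∀ t, Jt t = J₀ + t • tridiag K dp dq := fun t => ext_ez fun k => by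
    rw [hJt, add_apply, smul_apply, tridiag_ez hp hq, hJ₀]
    module
  obtain ⟨Ψ, Z, hΨ, hZ, hfirst, hsecond⟩ := exists_variation (K := K) (dp := dp) (dq := dq) hJ₀ A
  have hΦΨ : derivative Φ = Ψ := Polynomial.funext fun z => by
    rw [hΦ, hΨ, secondKind]
  replace ha : semicircleMass A = a := ha.symm
  rw [← eq_sum_ez hp hq hv, ha] at hsecond
  rw [ha] at hfirst
  set F : ℝ → ℝ := fun t => ∑' k, ⟪(aeval (J₀ + t • tridiag K dp dq) Φ - aeval J₀ Φ) (ez k), ez k⟫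
    with hF
  have hFderiv : ∀ t, HasDerivAt F
      (tridiagPairing K dp dq (aeval (J₀ + t • tridiag K dp dq) Ψ)) t := fun t => by
    rw [← hΦΨ]
    exact hasDerivAt_trace_sub _ _ _ _ J₀ Φ t
  have hFsmooth : ContDiff ℝ (⊤ : ℕ∞) F := by
    refine contDiff_infty_iff_deriv.2 ⟨fun t => (hFderiv t).differentiableAt, ?_⟩
    rw [funext fun t => (hFderiv t).deriv]
    exact (tridiagPairing K dp dq).contDiff.comp (contDiff_aeval_add_smul _ _ _)
  have hf' : f = fun t => -a * (∑ k ∈ K, Real.log (1 + t * dp k)) + F t := by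
    ext t
    rw [hf, hJ, tsum_eq_sum (s := K) fun k hk => by simp [hp k hk]]
  have hpos : ∀ᶠ t : ℝ in nhds 0, ∀ k ∈ K, 1 + t * dp k ≠ 0 := by
    refine (Finset.eventually_all K).2 fun k _ => ?_
    have : Continuous fun t : ℝ => 1 + t * dp k := by fun_prop
    exact this.continuousAt.eventually_ne (by simp)
  have hlin : ∀ k t, HasDerivAt (fun t : ℝ => 1 + t * dp k) (dp k) t := fun k t => by
    simpa using ((hasDerivAt_id t).mul_const (dp k)).const_add 1
  have hderiv : deriv f =ᶠ[nhds 0] fun t => -a * (∑ k ∈ K, dp k / (1 + t * dp k))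
      + tridiagPairing K dp dq (aeval (J₀ + t • tridiag K dp dq) Ψ) := by
    filter_upwards [hpos] with t ht
    rw [hf']
    exact (((HasDerivAt.fun_sum fun k hk => (hlin k t).log (ht k hk)).const_mul (-a)).add
      (hFderiv t)).deriv
  refine ⟨?_, ?_, ?_, ?_⟩
  · rw [hf']
    refine (contDiffAt_const.mul (ContDiffAt.sum fun k _ => ContDiffAt.log ?_ (by simp))).add
      hFsmooth.contDiffAt
    fun_prop
  · simp [hf', hF]
  · rw [hderiv.eq_of_nhds]
    simp [hfirst]
  · have hinv : ∀ k ∈ K, HasDerivAt (fun t : ℝ => dp k / (1 + t * dp k)) (-dp k ^ 2) 0 :=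
      fun k _ => by
        refine ((hasDerivAt_const (0 : ℝ) (dp k)).fun_div (hlin k 0) (by simp)).congr_deriv ?_
        simp [sq]
    have hpair := (tridiagPairing K dp dq).hasFDerivAt.comp_hasDerivAt (0 : ℝ) hZ
    rw [hderiv.deriv_eq, ← hsecond]
    refine (((HasDerivAt.fun_sum hinv).const_mul (-a)).add hpair).deriv.trans ?_
    rw [Finset.sum_neg_distrib]
    ring

end
end
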